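/- arXiv:2005.11874 — 4 statements merged into one kernel-verified Lean document; each statement's English description precedes it below -/
import Mathlib

section
/- Let G be a finite simple graph on a finite vertex set V and let f : V → ℝ be locally injective, i.e. f(u) ≠ f(w) whenever u and w are adjacent. For each vertex v define i_f(v) = 1 − χ(S_f⁻(v)), where S_f⁻(v) is the set of neighbors w of v with f(w) < f(v) and χ(S_f⁻(v)) denotes the Euler characteristic of the clique complex of the subgraph induced on S_f⁻(v). Then Σ_{v ∈ V} i_f(v) = χ(G), the Euler characteristic of the clique (Whitney) complex of G. -/
open scoped Classical in
/-- Including the empty set turns `1 - χ` into a sum of `(-1) ^ |x|`. -/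
lemma one_sub_sum_nonempty_eq_sum {V : Type*} [Fintype V] (P : Finset V → Prop) (hP : P ∅) :
    (1 : ℤ) - ∑ x ∈ Finset.univ.filter (fun x : Finset V => x.Nonempty ∧ P x),
        (-1 : ℤ) ^ (x.card - 1)
      = ∑ x ∈ Finset.univ.filter P, (-1 : ℤ) ^ x.card := by
  have hins : Finset.univ.filter P
      = insert ∅ (Finset.univ.filter (fun x : Finset V => x.Nonempty ∧ P x)) := by
    ext x
    rcases x.eq_empty_or_nonempty with rfl | hx
    · simp [hP]
    · simp [hx, hx.ne_empty]
  rw [hins, Finset.sum_insert (by simp), Finset.card_empty, pow_zero, sub_eq_add_neg,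
    ← Finset.sum_neg_distrib]
  congr 1
  refine Finset.sum_congr rfl fun x hx => ?_
  obtain ⟨n, hn⟩ := Nat.exists_eq_succ_of_ne_zero (Finset.mem_filter.1 hx).2.1.card_pos.ne'
  simp [hn, pow_succ]

open scoped Classical in
/-- **Poincaré–Hopf for graphs.**  Let `G` be a finite simple graph on a finite
vertex set `V` and `f : V → ℝ` locally injective (different values on adjacent
vertices).  With `i_f(v) = 1 - χ(S_f⁻(v))`, where `S_f⁻(v)` is the set of
neighbors `w` of `v` with `f w < f v` and `χ` denotes the Euler characteristic
of the clique complex (cliques of `G` contained in `S_f⁻(v)` are exactly the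
cliques of the induced subgraph), we have `∑_{v ∈ V} i_f(v) = χ(G)`, the Euler
characteristic of the clique (Whitney) complex of `G`. -/
theorem sum_poincare_hopf_index_eq_euler_characteristic
    {V : Type*} [Fintype V] (G : SimpleGraph V) (f : V → ℝ)
    (hf : ∀ u w : V, G.Adj u w → f u ≠ f w) :
    ∑ v : V,
      ((1 : ℤ) -
        ∑ x ∈ Finset.univ.filter (fun x : Finset V =>
            x.Nonempty ∧ G.IsClique (x : Set V) ∧ ∀ w ∈ x, G.Adj v w ∧ f w < f v),
          (-1 : ℤ) ^ (x.card - 1))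
      = ∑ x ∈ Finset.univ.filter (fun x : Finset V =>
            x.Nonempty ∧ G.IsClique (x : Set V)),
          (-1 : ℤ) ^ (x.card - 1) := by
  have hindex (v : V) := one_sub_sum_nonempty_eq_sum
    (fun x : Finset V => G.IsClique (x : Set V) ∧ ∀ w ∈ x, G.Adj v w ∧ f w < f v) (by simp)
  trans ∑ v : V, ∑ x ∈ Finset.univ.filter (fun x : Finset V =>
      G.IsClique (x : Set V) ∧ ∀ w ∈ x, G.Adj v w ∧ f w < f v), (-1 : ℤ) ^ x.card
  · refine Finset.sum_congr rfl fun v _ => ?_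
    convert hindex v
  -- A nonempty clique is uniquely its `f`-maximal vertex `v` joined to a clique in `S_f⁻(v)`.
  rw [Finset.sum_sigma']
  refine Finset.sum_bij (fun p _ => insert p.1 p.2) ?_ ?_ ?_ ?_
  · rintro ⟨v, x⟩ hp
    simp only [Finset.mem_sigma, Finset.mem_univ, Finset.mem_filter, true_and] at hp ⊢
    refine ⟨Finset.insert_nonempty _ _, ?_⟩
    rw [Finset.coe_insert]
    exact hp.1.insert fun w hw _ => (hp.2 w hw).1
  · rintro ⟨v, x⟩ hp ⟨w, y⟩ hq hxy
    simp only [Finset.mem_sigma, Finset.mem_univ, Finset.mem_filter, true_and] at hp hq hxy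
    have hvx : v ∉ x := fun h => lt_irrefl _ (hp.2 v h).2
    have hwy : w ∉ y := fun h => lt_irrefl _ (hq.2 w h).2
    have hvw : v = w := by
      have hv : v ∈ insert w y := hxy ▸ Finset.mem_insert_self v x
      have hw : w ∈ insert v x := hxy ▸ Finset.mem_insert_self w y
      rcases Finset.mem_insert.1 hv with h | h
      · exact h
      rcases Finset.mem_insert.1 hw with h' | h'
      · exact h'.symm
      exact absurd (hq.2 v h).2 (hp.2 w h').2.not_gt
    subst hvw
    rw [← Finset.erase_insert hvx, hxy, Finset.erase_insert hwy]
  · intro x hx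
    simp only [Finset.mem_filter, Finset.mem_univ, true_and] at hx
    obtain ⟨v, hv, hmax⟩ := x.exists_max_image f hx.1
    refine ⟨⟨v, x.erase v⟩, ?_, Finset.insert_erase hv⟩
    simp only [Finset.mem_sigma, Finset.mem_univ, Finset.mem_filter, true_and]
    refine ⟨hx.2.subset (Finset.coe_subset.2 (Finset.erase_subset v x)), fun w hw => ?_⟩
    obtain ⟨hne, hwx⟩ := Finset.mem_erase.1 hw
    have hadj : G.Adj v w := hx.2 hv hwx hne.symm
    exact ⟨hadj, (hmax w hwx).lt_of_ne (hf v w hadj).symm⟩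
  · rintro ⟨v, x⟩ hp
    simp only [Finset.mem_sigma, Finset.mem_univ, Finset.mem_filter, true_and] at hp
    rw [Finset.card_insert_of_notMem fun h => lt_irrefl _ (hp.2 v h).2, Nat.add_sub_cancel]
end

section
/- Let G be a finite abstract simplicial complex and let h : G → ℝ be any function. Define the matrix L, indexed by the simplices of G, by L(x,y) = Σ_{z ∈ G, z ⊆ x ∩ y} h(z). Then det(L) = Π_{x ∈ G} h(x). -/
/-- The incidence matrix of inclusion on a finite family of finite sets is unipotent. -/
theorem det_subset_incidence_eq_one {V : Type*} [DecidableEq V] (G : Finset (Finset V)) :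
    (Matrix.of fun z x : {x // x ∈ G} =>
      if (z : Finset V) ⊆ (x : Finset V) then (1 : ℝ) else 0).det = 1 := by
  set A : Matrix {x // x ∈ G} {x // x ∈ G} ℝ := Matrix.of fun z x =>
    if (z : Finset V) ⊆ (x : Finset V) then (1 : ℝ) else 0 with hA
  have htri : A.BlockTriangular fun x => (x : Finset V).card := by
    intro z x hlt
    simp only [hA, Matrix.of_apply, ite_eq_right_iff]
    intro hsub
    exact absurd (Finset.card_le_card hsub) (not_le.mpr hlt)
  rw [htri.det]
  refine Finset.prod_eq_one fun k _ => ?_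
  suffices hblock : A.toSquareBlock (fun x => (x : Finset V).card) k = 1 by
    rw [hblock, Matrix.det_one]
  ext z x
  have hiff : (z.1 : Finset V) ⊆ (x.1 : Finset V) ↔ z = x := by
    constructor
    · intro hsub
      exact Subtype.ext (Subtype.ext
        (Finset.eq_of_subset_of_card_le hsub (x.2.trans z.2.symm).le))
    · rintro rfl
      exact subset_rfl
  simp only [hA, Matrix.toSquareBlock_def, Matrix.of_apply, Matrix.one_apply, hiff]

/-- **Energy theorem (determinant form).**  Let `G` be a finite abstract
simplicial complex (a finite collection of nonempty finite subsets of a finite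
vertex set `V`, closed under taking nonempty subsets) and `h` any real-valued
function on the simplices.  For the matrix `L`, indexed by the simplices of
`G`, with `L x y = ∑_{z ∈ G, z ⊆ x ∩ y} h z`, one has
`det L = ∏_{x ∈ G} h x`. -/
theorem det_energy_matrix_eq_prod
    {V : Type*} [Fintype V] [DecidableEq V]
    (G : Finset (Finset V))
    (hne : ∀ x ∈ G, x.Nonempty)
    (hclosed : ∀ x ∈ G, ∀ y : Finset V, y ⊆ x → y.Nonempty → y ∈ G)
    (h : Finset V → ℝ)
    (L : Matrix {x // x ∈ G} {x // x ∈ G} ℝ)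
    (hL : ∀ x y : {x // x ∈ G},
      L x y = ∑ z ∈ G.filter (fun z => z ⊆ (x : Finset V) ∩ (y : Finset V)), h z) :
    L.det = ∏ x ∈ G, h x := by
  set A : Matrix {x // x ∈ G} {x // x ∈ G} ℝ := Matrix.of fun z x =>
    if (z : Finset V) ⊆ (x : Finset V) then (1 : ℝ) else 0 with hA
  have hfactor : L = A.transpose * Matrix.diagonal (fun z : {x // x ∈ G} => h z) * A := by
    ext x y
    rw [hL, Finset.sum_filter, ← Finset.sum_coe_sort G, Matrix.mul_apply]
    refine Finset.sum_congr rfl fun z _ => ?_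
    simp only [Matrix.mul_diagonal, Matrix.transpose_apply, hA, Matrix.of_apply,
      Finset.subset_inter_iff]
    by_cases hx : (z : Finset V) ⊆ x <;> by_cases hy : (z : Finset V) ⊆ y <;> simp [hx, hy]
  rw [hfactor, Matrix.det_mul, Matrix.det_mul, Matrix.det_transpose, Matrix.det_diagonal,
    det_subset_incidence_eq_one G, one_mul, mul_one, Finset.prod_coe_sort G h]
end

section
/- Let G be a finite abstract simplicial complex with n = |G| simplices, and define the counting matrix L, indexed by the simplices of G, by L(x,y) = number of simplices z ∈ G with z ⊆ x ∩ y. Then L is a symmetric positive definite matrix with det(L) = 1, its inverse g = L⁻¹ has integer entries, and Σ_{x,y ∈ G} g(x,y) = n, the number of simplices in G. -/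
open Matrix

/-- The zeta matrix of a family of finite sets ordered by inclusion. -/
def faceMatrix {V : Type*} [DecidableEq V] (G : Finset (Finset V)) :
    Matrix {x // x ∈ G} {x // x ∈ G} ℤ :=
  Matrix.of fun x z => if (z : Finset V) ⊆ x then 1 else 0

/-- The signed inclusion matrix of a family of finite sets; it is the Möbius matrix when the family is
a simplicial complex. -/
def signedFaceMatrix {V : Type*} [DecidableEq V] (G : Finset (Finset V)) :
    Matrix {x // x ∈ G} {x // x ∈ G} ℤ :=
  Matrix.of fun x z =>
    if (z : Finset V) ⊆ x then (-1) ^ ((x : Finset V).card + (z : Finset V).card)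
    else 0

lemma sum_Icc_neg_one_pow_card {V : Type*} [DecidableEq V] {y x : Finset V} (h : y ⊆ x) :
    ∑ z ∈ Finset.Icc y x, (-1 : ℤ) ^ (x.card + z.card) = if x = y then 1 else 0 := by
  rw [Finset.Icc_eq_image_powerset h, Finset.sum_image]
  · have hterm : ∀ t ∈ (x \ y).powerset, (-1 : ℤ) ^ (x.card + (y ∪ t).card)
        = (-1) ^ (x.card + y.card) * (-1) ^ t.card := by
      intro t ht
      rw [Finset.card_union_of_disjoint, ← pow_add, add_assoc]
      exact Finset.disjoint_of_subset_right (Finset.mem_powerset.1 ht) Finset.disjoint_sdiff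
    rw [Finset.sum_congr rfl hterm, ← Finset.mul_sum, Finset.sum_powerset_neg_one_pow_card]
    by_cases hxy : x = y
    · subst hxy
      simp [← two_mul]
    · have : x \ y ≠ ∅ := fun h0 =>
        hxy ((Finset.sdiff_eq_empty_iff_subset.1 h0).antisymm h)
      simp [hxy, this]
  · intro s hs t ht hst
    have hs' := Finset.disjoint_of_subset_right
      (Finset.mem_powerset.1 (Finset.mem_coe.1 hs)) (Finset.disjoint_sdiff (s := y) (t := x))
    have ht' := Finset.disjoint_of_subset_right
      (Finset.mem_powerset.1 (Finset.mem_coe.1 ht)) (Finset.disjoint_sdiff (s := y) (t := x))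
    rw [← Finset.union_sdiff_cancel_left hs', ← Finset.union_sdiff_cancel_left ht']
    exact congrArg (· \ y) hst

section

variable {V : Type*} [DecidableEq V] {G : Finset (Finset V)}

lemma signedFaceMatrix_mul_faceMatrix (hne : ∀ x ∈ G, x.Nonempty)
    (hclosed : ∀ x ∈ G, ∀ y : Finset V, y ⊆ x → y.Nonempty → y ∈ G) :
    signedFaceMatrix G * faceMatrix G = 1 := by
  ext x y
  have hsum : (signedFaceMatrix G * faceMatrix G) x y =
      ∑ z ∈ G, if z ∈ Finset.Icc (y : Finset V) x
        then (-1 : ℤ) ^ ((x : Finset V).card + z.card) else 0 := by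
    rw [Matrix.mul_apply, ← Finset.sum_coe_sort G]
    refine Finset.sum_congr rfl fun z _ => ?_
    simp only [signedFaceMatrix, faceMatrix, Matrix.of_apply, Finset.mem_Icc]
    split_ifs <;> simp_all
  have hfilter : G.filter (· ∈ Finset.Icc (y : Finset V) x) = Finset.Icc (y : Finset V) x := by
    ext z
    simp only [Finset.mem_filter, Finset.mem_Icc, and_iff_right_iff_imp]
    exact fun h => hclosed x x.2 z h.2 ((hne y y.2).mono h.1)
  rw [hsum, ← Finset.sum_filter, hfilter, Matrix.one_apply]
  by_cases h : (y : Finset V) ⊆ x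
  · simp only [sum_Icc_neg_one_pow_card h, Subtype.ext_iff]
  · have hxy : x ≠ y := fun e => h (e ▸ subset_rfl)
    simp [Finset.Icc_eq_empty (a := (y : Finset V)) (b := x) h, hxy]

lemma faceMatrix_mulVec_neg_one_pow (hne : ∀ x ∈ G, x.Nonempty)
    (hclosed : ∀ x ∈ G, ∀ y : Finset V, y ⊆ x → y.Nonempty → y ∈ G) :
    faceMatrix G *ᵥ (fun z : {x // x ∈ G} => -(-1) ^ (z : Finset V).card) = 1 := by
  ext x
  have hfilter : G.filter (· ⊆ (x : Finset V)) = (x : Finset V).powerset.erase ∅ := by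
    ext z
    simp only [Finset.mem_filter, Finset.mem_erase, Finset.mem_powerset,
      ← Finset.nonempty_iff_ne_empty]
    exact ⟨fun h => ⟨hne z h.1, h.2⟩, fun h => ⟨hclosed x x.2 z h.2 h.1, h.2⟩⟩
  have hsum : (faceMatrix G *ᵥ (fun z : {x // x ∈ G} => -(-1) ^ (z : Finset V).card)) x =
      -∑ z ∈ G, if z ⊆ (x : Finset V) then (-1 : ℤ) ^ z.card else 0 := by
    rw [← Finset.sum_coe_sort G, ← Finset.sum_neg_distrib]
    refine Finset.sum_congr rfl fun z _ => ?_
    simp only [faceMatrix, Matrix.of_apply]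
    split_ifs <;> simp
  rw [hsum, ← Finset.sum_filter, hfilter,
    Finset.sum_erase_eq_sub (Finset.empty_mem_powerset _),
    Finset.sum_powerset_neg_one_pow_card_of_nonempty (hne x x.2)]
  simp

lemma signedFaceMatrix_mulVec_one (hne : ∀ x ∈ G, x.Nonempty)
    (hclosed : ∀ x ∈ G, ∀ y : Finset V, y ⊆ x → y.Nonempty → y ∈ G) :
    signedFaceMatrix G *ᵥ 1 = fun z : {x // x ∈ G} => -(-1) ^ (z : Finset V).card := by
  rw [← faceMatrix_mulVec_neg_one_pow hne hclosed, Matrix.mulVec_mulVec,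
    signedFaceMatrix_mul_faceMatrix hne hclosed, Matrix.one_mulVec]

lemma faceMatrix_mul_transpose_apply (x y : {x // x ∈ G}) :
    (faceMatrix G * (faceMatrix G)ᵀ) x y =
      ((G.filter (fun z => z ⊆ (x : Finset V) ∩ (y : Finset V))).card : ℤ) := by
  rw [Finset.card_filter, Nat.cast_sum, Matrix.mul_apply, ← Finset.sum_coe_sort G]
  refine Finset.sum_congr rfl fun z _ => ?_
  simp only [faceMatrix, Matrix.of_apply, Matrix.transpose_apply, Finset.subset_inter_iff]
  split_ifs <;> simp_all

end

/-- **The counting matrix of a simplicial complex.**  Let `G` be a finite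
abstract simplicial complex with `n = |G|` simplices, and let `L` be the
counting matrix `L x y = #{z ∈ G | z ⊆ x ∩ y}` indexed by the simplices of
`G`.  Then `L` is symmetric and positive definite, `det L = 1`, the inverse
(Green function) `g = L⁻¹` has integer entries, and
`∑_{x,y} g x y = n`. -/
theorem counting_matrix_unimodular
    {V : Type*} [Fintype V] [DecidableEq V]
    (G : Finset (Finset V))
    (hne : ∀ x ∈ G, x.Nonempty)
    (hclosed : ∀ x ∈ G, ∀ y : Finset V, y ⊆ x → y.Nonempty → y ∈ G)
    (L : Matrix {x // x ∈ G} {x // x ∈ G} ℝ)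
    (hL : ∀ x y : {x // x ∈ G},
      L x y = ((G.filter (fun z => z ⊆ (x : Finset V) ∩ (y : Finset V))).card : ℝ)) :
    L.IsSymm ∧ L.PosDef ∧ L.det = 1 ∧
      (∀ x y : {x // x ∈ G}, ∃ m : ℤ, L⁻¹ x y = (m : ℝ)) ∧
      ∑ x : {x // x ∈ G}, ∑ y : {x // x ∈ G}, L⁻¹ x y = (G.card : ℝ) := by
  have hMA := signedFaceMatrix_mul_faceMatrix hne hclosed
  have hAM := mul_eq_one_comm.1 hMA
  set A := faceMatrix G
  set M := signedFaceMatrix G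
  let φ := Int.castRingHom ℝ
  have hLA : L = (A * Aᵀ).map φ := by
    ext x y
    rw [hL, Matrix.map_apply, faceMatrix_mul_transpose_apply]
    simp [φ]
  have hLM : L⁻¹ = (Mᵀ * M).map φ := by
    refine Matrix.inv_eq_right_inv ?_
    have hint : A * Aᵀ * (Mᵀ * M) = 1 := by
      rw [Matrix.mul_assoc, ← Matrix.mul_assoc Aᵀ, ← Matrix.transpose_mul, hMA,
        Matrix.transpose_one, Matrix.one_mul, hAM]
    rw [hLA, ← Matrix.map_mul, hint, Matrix.map_one _ φ.map_zero φ.map_one]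
  have hdet : A.det * A.det = 1 := by
    have hunit : IsUnit A.det := IsUnit.of_mul_eq_one M.det (by rw [← Matrix.det_mul, hAM, det_one])
    exact Int.isUnit_mul_self hunit
  refine ⟨?_, ?_, ?_, fun x y => ⟨(Mᵀ * M) x y, by simp [hLM, φ]⟩, ?_⟩
  · ext x y
    simp [hL, Finset.inter_comm]
  · have hLA' : L = A.map φ * (A.map φ)ᴴ := by
      rw [hLA, Matrix.map_mul, Matrix.conjTranspose_eq_transpose_of_trivial, Matrix.transpose_map]
    rw [hLA']
    refine Matrix.PosDef.mul_conjTranspose_self _ ?_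
    refine Matrix.vecMul_injective_of_isUnit (IsUnit.of_mul_eq_one (M.map φ) ?_)
    rw [← Matrix.map_mul, hAM, Matrix.map_one _ φ.map_zero φ.map_one]
  · rw [hLA, ← RingHom.mapMatrix_apply, ← RingHom.map_det, Matrix.det_mul, Matrix.det_transpose,
      hdet, map_one]
  · have hsum : ∑ x, ∑ y, (Mᵀ * M) x y = (M *ᵥ 1) ⬝ᵥ (M *ᵥ 1) := by
      rw [Matrix.dotProduct_mulVec, ← Matrix.mulVec_transpose, Matrix.mulVec_mulVec,
        dotProduct_one]
      simp [Matrix.mulVec, dotProduct_one]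
    have hcard : ∑ x, ∑ y, (Mᵀ * M) x y = (G.card : ℤ) := by
      rw [hsum, signedFaceMatrix_mulVec_one hne hclosed]
      simp [dotProduct, ← pow_add, ← two_mul]
    rw [hLM]
    simp only [Matrix.map_apply, ← map_sum, hcard]
    simp [φ]
end

section
/- Let G be a finite abstract simplicial complex and let h : G → ℝ be a function taking only the values 1 and −1. Define the matrix L, indexed by the simplices of G, by L(x,y) = Σ_{z ∈ G, z ⊆ x ∩ y} h(z). Then L is invertible, and its inverse g = L⁻¹ satisfies Σ_{x,y ∈ G} g(x,y) = Σ_{x ∈ G} h(x). -/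
open Matrix

namespace SimplicialEnergy

variable {V : Type*}

/-- The vector of signs `(-1) ^ dim z`, where `dim z = |z| - 1`. -/
def signVector (G : Finset (Finset V)) : {x // x ∈ G} → ℝ :=
  fun z => -(-1) ^ (z : Finset V).card

theorem signVector_mul_self (G : Finset (Finset V)) (z : {x // x ∈ G}) :
    signVector G z * signVector G z = 1 := by
  simp [signVector, ← mul_pow]

variable [DecidableEq V]

/-- The zeta matrix of a family of finite sets, ordered by inclusion. -/
def zetaMatrix (G : Finset (Finset V)) : Matrix {x // x ∈ G} {x // x ∈ G} ℝ :=
  fun x z => if (z : Finset V) ⊆ x then 1 else 0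

theorem isUnit_zetaMatrix (G : Finset (Finset V)) : IsUnit (zetaMatrix G) := by
  rw [← Matrix.mulVec_injective_iff_isUnit]
  refine (injective_iff_map_eq_zero (Matrix.mulVecLin (zetaMatrix G))).2 fun v hv => ?_
  have key : ∀ s : Finset V, ∀ hs : s ∈ G, v ⟨s, hs⟩ = 0 := by
    intro s
    induction s using Finset.strongInduction with
    | H s ih =>
      intro hs
      have hsum : ∑ z, zetaMatrix G ⟨s, hs⟩ z * v z = 0 := congrFun hv ⟨s, hs⟩
      rw [Finset.sum_eq_single ⟨s, hs⟩] at hsum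
      · simpa [zetaMatrix] using hsum
      · rintro ⟨z, hz⟩ - hne
        by_cases hzs : z ⊆ s
        · rw [ih z (hzs.ssubset_of_ne fun e => hne (Subtype.ext e)) hz, mul_zero]
        · simp [zetaMatrix, hzs]
      · simp
  funext z
  exact key z z.2

/-- Every simplex has Euler characteristic one. -/
theorem zetaMatrix_mulVec_signVector (G : Finset (Finset V))
    (hne : ∀ x ∈ G, x.Nonempty)
    (hclosed : ∀ x ∈ G, ∀ y : Finset V, y ⊆ x → y.Nonempty → y ∈ G) :
    zetaMatrix G *ᵥ signVector G = 1 := by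
  funext x
  have hfaces : G.filter (fun z => z ⊆ (x : Finset V)) = (x : Finset V).powerset.erase ∅ := by
    ext z
    simp only [Finset.mem_filter, Finset.mem_erase, Finset.mem_powerset]
    exact ⟨fun hz => ⟨(hne z hz.1).ne_empty, hz.2⟩, fun hz =>
      ⟨hclosed x x.2 z hz.2 (Finset.nonempty_iff_ne_empty.2 hz.1), hz.2⟩⟩
  have hEuler : ∑ z ∈ (x : Finset V).powerset, (-1 : ℝ) ^ z.card = 0 := by
    exact_mod_cast Finset.sum_powerset_neg_one_pow_card_of_nonempty (hne x x.2)
  have hsplit := Finset.sum_erase_add (x : Finset V).powerset (fun z => (-1 : ℝ) ^ z.card)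
    (Finset.empty_mem_powerset _)
  rw [hEuler, Finset.card_empty, pow_zero] at hsplit
  calc (zetaMatrix G *ᵥ signVector G) x
      = ∑ z : {x // x ∈ G}, if (z : Finset V) ⊆ x then -(-1 : ℝ) ^ (z : Finset V).card else 0 := by
        simp only [Matrix.mulVec, dotProduct, zetaMatrix, signVector, ite_mul, one_mul, zero_mul]
    _ = ∑ z ∈ G, if z ⊆ (x : Finset V) then -(-1 : ℝ) ^ z.card else 0 :=
        Finset.sum_coe_sort G fun z => if z ⊆ (x : Finset V) then -(-1 : ℝ) ^ z.card else 0
    _ = 1 := by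
        rw [← Finset.sum_filter, hfaces, Finset.sum_neg_distrib]
        linarith

theorem zetaMatrix_mul_diagonal_mul_transpose_apply (G : Finset (Finset V)) (h : Finset V → ℝ)
    (x y : {x // x ∈ G}) :
    (zetaMatrix G * diagonal (fun z : {x // x ∈ G} => h z) * (zetaMatrix G)ᵀ) x y =
      ∑ z ∈ G.filter (fun z => z ⊆ (x : Finset V) ∩ (y : Finset V)), h z := by
  rw [Finset.sum_filter, ← Finset.sum_coe_sort G, Matrix.mul_apply]
  refine Finset.sum_congr rfl fun z _ => ?_
  rw [Matrix.mul_diagonal, Matrix.transpose_apply]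
  simp only [zetaMatrix, Finset.subset_inter_iff]
  split_ifs <;> simp_all

end SimplicialEnergy

open SimplicialEnergy

/-- **Energy theorem for unit-valued energies.**  Let `G` be a finite abstract
simplicial complex and `h : G → ℝ` a function taking only the values `1` and
`-1`.  For the matrix `L x y = ∑_{z ∈ G, z ⊆ x ∩ y} h z` indexed by the
simplices of `G`, the matrix `L` is invertible and its inverse `g = L⁻¹`
satisfies `∑_{x,y ∈ G} g x y = ∑_{x ∈ G} h x`. -/
theorem energy_matrix_invertible_and_green_sum
    {V : Type*} [Fintype V] [DecidableEq V]
    (G : Finset (Finset V))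
    (hne : ∀ x ∈ G, x.Nonempty)
    (hclosed : ∀ x ∈ G, ∀ y : Finset V, y ⊆ x → y.Nonempty → y ∈ G)
    (h : Finset V → ℝ)
    (hh : ∀ x ∈ G, h x = 1 ∨ h x = -1)
    (L : Matrix {x // x ∈ G} {x // x ∈ G} ℝ)
    (hL : ∀ x y : {x // x ∈ G},
      L x y = ∑ z ∈ G.filter (fun z => z ⊆ (x : Finset V) ∩ (y : Finset V)), h z) :
    IsUnit L.det ∧
      ∑ x : {x // x ∈ G}, ∑ y : {x // x ∈ G}, L⁻¹ x y = ∑ x ∈ G, h x := by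
  set Z := zetaMatrix G
  set D : Matrix {x // x ∈ G} {x // x ∈ G} ℝ := diagonal fun z => h z
  have hfactor : L = Z * D * Zᵀ := by
    ext x y
    rw [hL, zetaMatrix_mul_diagonal_mul_transpose_apply]
  have hDD : D * D = 1 := by
    rw [diagonal_mul_diagonal, ← diagonal_one]
    congr 1
    funext z
    rcases hh z z.2 with e | e <;> simp [e]
  have hZ : IsUnit Z.det := (Matrix.isUnit_iff_isUnit_det Z).1 (isUnit_zetaMatrix G)
  have hD : IsUnit D.det := Matrix.isUnit_det_of_left_inverse hDD
  refine ⟨by rw [hfactor, det_mul, det_mul, det_transpose]; exact (hZ.mul hD).mul hZ, ?_⟩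
  have hinv : L⁻¹ = (Z⁻¹)ᵀ * D * Z⁻¹ := by
    rw [hfactor, Matrix.mul_inv_rev, Matrix.mul_inv_rev, inv_eq_left_inv hDD, ← transpose_nonsing_inv,
      Matrix.mul_assoc]
  have hsign : Z⁻¹ *ᵥ 1 = signVector G := by
    rw [← zetaMatrix_mulVec_signVector G hne hclosed, mulVec_mulVec, nonsing_inv_mul _ hZ,
      one_mulVec]
  calc ∑ x, ∑ y, L⁻¹ x y = 1 ⬝ᵥ L⁻¹ *ᵥ 1 := by simp [dotProduct, mulVec]
    _ = signVector G ⬝ᵥ D *ᵥ signVector G := by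
        rw [hinv, ← mulVec_mulVec, ← mulVec_mulVec, hsign, dotProduct_mulVec, vecMul_transpose,
          hsign]
    _ = ∑ z : {x // x ∈ G}, h z := by
        refine Finset.sum_congr rfl fun z _ => ?_
        rw [mulVec_diagonal, mul_left_comm, signVector_mul_self, mul_one]
    _ = ∑ x ∈ G, h x := Finset.sum_coe_sort G h
end
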